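/- Assume K = 1 and B < -1, and set p_i = 1/2 - r_i, q_i = 1 - p_i, ρ_i = q_i/p_i, π_n = ∏_{i=1}^n ρ_i, and Q_n = π_n / ((1 + Σ_{j=1}^{n-1} π_j)(1 + Σ_{j=1}^{n} π_j)). Then there exists a constant c > 0 such that Q_n ~ c · n^B as n → ∞. -/

import Mathlib

open Filter Finset

noncomputable section

/-- Iterated logarithm: `iterLog 0 x = x`, `iterLog (k+1) x = log (iterLog k x)`. -/
def iterLog : ℕ → ℝ → ℝ
  | 0, x => x
  | k + 1, x => Real.log (iterLog k x)

/-- Product `log_0 x · log_1 x ⋯ log_{K-1} x = x · log x ⋯ log_{K-1} x`. -/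
def itLogProd (K : ℕ) (x : ℝ) : ℝ := ∏ m ∈ Finset.range K, iterLog m x

/-- `Λ(K,x,B) = 1/x + 1/(x log x) + ⋯ + 1/(x log x ⋯ log_{K-2} x)
      + B/(x log x ⋯ log_{K-1} x)`; in particular `Λ(1,x,B) = B/x`. -/
def Lam (K : ℕ) (x B : ℝ) : ℝ :=
  (∑ j ∈ Finset.Icc 1 (K - 1), (itLogProd j x)⁻¹) + B / itLogProd K x

/-- `i₀ = min{ i : log_{K-1} i > 0 and |Λ(K,i,B)|/4 < 1/2 }`. -/
def i0 (K : ℕ) (B : ℝ) : ℕ :=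
  sInf {i : ℕ | 0 < iterLog (K - 1) (i : ℝ) ∧ |Lam K (i : ℝ) B| / 4 < 1 / 2}

/-- The perturbation `r_i = Λ(K,i,B)/4` for `i ≥ i₀`, and `r_i = r_{i₀}` for `i < i₀`. -/
def rr (K : ℕ) (B : ℝ) (i : ℕ) : ℝ :=
  if i0 K B ≤ i then Lam K (i : ℝ) B / 4 else Lam K (i0 K B : ℝ) B / 4

theorem i0_one_spec (B : ℝ) : 0 < (i0 1 B : ℝ) ∧ |B / (i0 1 B : ℝ)| / 4 < 1 / 2 := by
  have hne : {i : ℕ | 0 < iterLog (1 - 1) (i : ℝ) ∧ |Lam 1 (i : ℝ) B| / 4 < 1 / 2}.Nonempty := by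
    obtain ⟨n, hn⟩ := exists_nat_gt |B|
    have hn0 : (0 : ℝ) < n := (abs_nonneg B).trans_lt hn
    refine ⟨n, by simpa [iterLog] using hn0, ?_⟩
    have : |B| / n < 1 := (div_lt_one hn0).2 hn
    simp only [Lam, itLogProd, iterLog, tsub_self, Finset.range_one, Finset.prod_singleton,
      abs_div, Nat.abs_cast, Nat.lt_one_iff, pos_of_gt, Icc_eq_empty_of_lt, Finset.sum_empty,
      zero_add]
    linarith
  simpa [i0, Lam, itLogProd, iterLog] using Nat.sInf_mem hne

theorem rr_one_of_le {B : ℝ} {i : ℕ} (hi : i0 1 B ≤ i) : rr 1 B i = B / i / 4 := by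
  simp [rr, hi, Lam, itLogProd, iterLog]

theorem abs_rr_one_lt (B : ℝ) (i : ℕ) : |rr 1 B i| < 1 / 2 := by
  obtain ⟨h0, h⟩ := i0_one_spec B
  have key : |rr 1 B i| ≤ |B / (i0 1 B : ℝ)| / 4 := by
    by_cases hi : i0 1 B ≤ i
    · have hi' : (i0 1 B : ℝ) ≤ i := by exact_mod_cast hi
      rw [rr_one_of_le hi, abs_div, abs_div, abs_div, abs_of_pos h0, Nat.abs_cast,
        abs_of_pos (four_pos : (0 : ℝ) < 4)]
      gcongr
    · simp [rr, hi, Lam, itLogProd, iterLog, abs_div]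
  exact key.trans_lt h

/-- A product of ratios `(s + j) / (t + j)` is asymptotic to `Γ(t) / Γ(s) * n ^ (s - t)`. -/
theorem tendsto_prod_add_div_add {s t : ℝ} (hs : 0 < s) (ht : 0 < t) :
    Tendsto (fun n : ℕ => (∏ j ∈ Finset.range (n + 1), (s + j) / (t + j)) / (n : ℝ) ^ (s - t))
      atTop (nhds (Real.Gamma t / Real.Gamma s)) := by
  refine ((Real.GammaSeq_tendsto_Gamma t).div (Real.GammaSeq_tendsto_Gamma s)
    (Real.Gamma_pos_of_pos hs).ne').congr' ?_
  filter_upwards [eventually_gt_atTop 0] with n hn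
  have hn' : (0 : ℝ) < n := by exact_mod_cast hn
  have h1 : (∏ j ∈ Finset.range (n + 1), (s + (j : ℝ))) ≠ 0 :=
    (Finset.prod_pos fun j _ => by positivity).ne'
  have h2 : (∏ j ∈ Finset.range (n + 1), (t + (j : ℝ))) ≠ 0 :=
    (Finset.prod_pos fun j _ => by positivity).ne'
  have h3 := (Real.rpow_pos_of_pos hn' s).ne'
  have h4 := (Real.rpow_pos_of_pos hn' t).ne'
  have h5 : (n.factorial : ℝ) ≠ 0 := by positivity
  simp only [Pi.div_apply, Real.GammaSeq]
  rw [Finset.prod_div_distrib, Real.rpow_sub hn']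
  field_simp

theorem tendsto_natCast_add_rpow_div (m : ℕ) (B : ℝ) :
    Tendsto (fun n : ℕ => (n : ℝ) ^ B / ((n + m : ℕ) : ℝ) ^ B) atTop (nhds 1) := by
  have h := (tendsto_natCast_div_add_atTop (𝕜 := ℝ) (m : ℝ)).rpow_const (p := B)
    (Or.inl one_ne_zero)
  rw [Real.one_rpow] at h
  refine h.congr fun n => ?_
  rw [Real.div_rpow (by positivity) (by positivity), Nat.cast_add]

/-- A sequence `u n ~ a * n ^ B` with `B < -1` is summable. -/
theorem summable_of_tendsto_div_rpow {u : ℕ → ℝ} {a B : ℝ} (hB : B < -1)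
    (h : Tendsto (fun n : ℕ => u n / (n : ℝ) ^ B) atTop (nhds a)) : Summable u := by
  refine summable_of_isBigO_nat (Real.summable_nat_rpow.2 hB) ?_
  refine Asymptotics.isBigO_of_div_tendsto_nhds ?_ a h
  filter_upwards [eventually_gt_atTop 0] with n hn h0
  have hn' : (0 : ℝ) < n := by exact_mod_cast hn
  exact absurd h0 (Real.rpow_pos_of_pos hn' B).ne'

/-- case `K = 1`, `B < -1`, `p_i = 1/2 - r_i`: `Q_n ~ c · n^B`. -/
theorem stmt12 (K : ℕ) (hK : K = 1) (B : ℝ) (hB : B < -1)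
    (p q ρ π Q : ℕ → ℝ)
    (hp : ∀ i : ℕ, 1 ≤ i → p i = 1 / 2 - rr K B i)
    (hq : ∀ i : ℕ, q i = 1 - p i)
    (hρ : ∀ i : ℕ, ρ i = q i / p i)
    (hπ : ∀ n : ℕ, π n = ∏ i ∈ Finset.Icc 1 n, ρ i)
    (hQ : ∀ n : ℕ, Q n = π n /
      ((1 + ∑ j ∈ Finset.Icc 1 (n - 1), π j) * (1 + ∑ j ∈ Finset.Icc 1 n, π j))) :
    ∃ c : ℝ, 0 < c ∧ Tendsto
      (fun n : ℕ => Q n / (n : ℝ) ^ B)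
      atTop (nhds c) := by
  subst hK
  set m := i0 1 B with hm
  obtain ⟨hm0, hm1⟩ := i0_one_spec B
  rw [← hm] at hm0 hm1
  have hmpos : 1 ≤ m := by exact_mod_cast hm0
  have hBm : |B| < 2 * m := by
    rw [abs_div, Nat.abs_cast, div_div, div_lt_iff₀ (by positivity)] at hm1
    linarith
  obtain ⟨hBm1, hBm2⟩ := abs_lt.1 hBm
  have hρpos : ∀ i, 1 ≤ i → 0 < ρ i := by
    intro i hi
    obtain ⟨h1, h2⟩ := abs_lt.1 (abs_rr_one_lt B i)
    rw [hρ, hq, hp i hi]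
    exact div_pos (by linarith) (by linarith)
  have hπpos : ∀ n, 0 < π n := fun n => by
    rw [hπ]
    exact Finset.prod_pos fun i hi => hρpos i (Finset.mem_Icc.1 hi).1
  have hπsucc : ∀ n, π (n + 1) = π n * ρ (n + 1) := fun n => by
    rw [hπ, hπ, Finset.prod_Icc_succ_top (by omega)]
  have hρeq : ∀ j : ℕ, ρ (m + j) = (m + B / 2 + j) / (m - B / 2 + j) := by
    intro j
    have hj : (0 : ℝ) ≤ j := Nat.cast_nonneg j
    have hmj : (m : ℝ) + j ≠ 0 := by positivity
    have hd : (m : ℝ) - B / 2 + j ≠ 0 := by linarith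
    have hrr : rr 1 B (m + j) = B / (m + j) / 4 := by
      rw [rr_one_of_le (Nat.le_add_right _ _), Nat.cast_add]
    have hd' : (1 : ℝ) / 2 - B / (m + j) / 4 ≠ 0 := by
      have : (1 : ℝ) / 2 - B / (m + j) / 4 = (m - B / 2 + j) / (2 * (m + j)) := by
        field_simp
        ring
      rw [this]
      positivity
    rw [hρ, hq, hp _ (by omega), hrr, div_eq_div_iff hd' hd]
    field_simp
    ring
  have hπprod : ∀ n : ℕ, π (n + m) = π (m - 1) *
      ∏ j ∈ Finset.range (n + 1), ((m : ℝ) + B / 2 + j) / (m - B / 2 + j) := by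
    intro n
    induction n with
    | zero =>
      have h := hπsucc (m - 1)
      rw [Nat.sub_add_cancel hmpos] at h
      simpa [h, (hπpos (m - 1)).ne'] using hρeq 0
    | succ n ih =>
      rw [Finset.prod_range_succ, ← mul_assoc, ← ih, ← hρeq, add_right_comm, hπsucc]
      congr 2
      omega
  have hs : 0 < (m : ℝ) + B / 2 := by linarith
  have ht : 0 < (m : ℝ) - B / 2 := by linarith
  obtain ⟨a, ha, hlim⟩ : ∃ a : ℝ, 0 < a ∧
      Tendsto (fun n : ℕ => π n / (n : ℝ) ^ B) atTop (nhds a) := by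
    refine ⟨π (m - 1) * (Real.Gamma (m - B / 2) / Real.Gamma (m + B / 2)) * 1, ?_, ?_⟩
    · have := hπpos (m - 1)
      have := Real.Gamma_pos_of_pos hs
      have := Real.Gamma_pos_of_pos ht
      positivity
    · rw [← tendsto_add_atTop_iff_nat m]
      refine (((tendsto_prod_add_div_add hs ht).const_mul (π (m - 1))).mul
        (tendsto_natCast_add_rpow_div m B)).congr' ?_
      filter_upwards [eventually_gt_atTop 0] with n hn
      have hn' : (0 : ℝ) < n := by exact_mod_cast hn
      have h1 := (Real.rpow_pos_of_pos hn' B).ne'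
      rw [hπprod, show (m : ℝ) + B / 2 - (m - B / 2) = B by ring]
      field_simp
  have hsum : Summable π := summable_of_tendsto_div_rpow hB hlim
  have hS : 0 < ∑' n, π n := hsum.tsum_pos (fun n => (hπpos n).le) 0 (hπpos 0)
  have hIcc : ∀ n, 1 + ∑ j ∈ Finset.Icc 1 n, π j = ∑ j ∈ Finset.range (n + 1), π j := by
    intro n
    have h0 : π 0 = 1 := by simp [hπ]
    rw [Finset.range_eq_Ico, Finset.sum_eq_sum_Ico_succ_bot (Nat.succ_pos n), h0]
    rfl
  have hT := hsum.hasSum.tendsto_sum_nat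
  refine ⟨a / ((∑' n, π n) * ∑' n, π n), by positivity, ?_⟩
  refine (hlim.div (hT.mul ((tendsto_add_atTop_iff_nat 1).2 hT)) (by positivity)).congr' ?_
  filter_upwards [eventually_ge_atTop 1] with n hn
  rw [hQ, hIcc, hIcc, Nat.sub_add_cancel hn]
  simp only [Pi.div_apply]
  exact div_right_comm _ _ _
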